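/- Let A be a Poisson algebra over ℂ, η ∈ ℂ, and let a, b, c ∈ A[X] with b monic satisfy the rational (XXX) loop-sl₂ relations with parameter η. Let f ∈ ℂ[X] ⊆ A[X], and let G be the quotient of f upon polynomial division by the monic polynomial b, and Q the quotient of f upon division by b² (these are the polynomial parts [f·b⁻¹]₊ and [f·b⁻²]₊ of the Laurent expansions at λ = ∞). Then the deformed matrix L(λ) = [[a(λ), b(λ)],[G(λ) + c(λ), −a(λ)]] satisfies, as an identity of 4×4 matrices over A[λ,μ]: (λ−μ)·{L₁(λ) ⊗, L₂(μ)} = η·[Π, L₁(λ) + L₂(μ)] + η·(Q(λ) − Q(μ))·[σ₋⊗σ₋, L₁(λ) − L₂(μ)], where L₁(λ) = L(λ)⊗I and L₂(μ) = I⊗L(μ). Equivalently, L obeys the rs-matrix algebra with r(λ,μ) = η·Π/(λ−μ) and the dynamical matrix s(λ,μ) = η·((Q(λ)−Q(μ))/(λ−μ))·σ₋⊗σ₋, whose coefficient is the polynomial divided difference of Q. -/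

import Mathlib

open Matrix Kronecker Polynomial

/-- A Poisson algebra over ℂ. -/
structure PoissonC (A : Type*) [CommRing A] [Algebra ℂ A] where
  br : A → A → A
  add_left : ∀ x y z : A, br (x + y) z = br x z + br y z
  add_right : ∀ x y z : A, br x (y + z) = br x y + br x z
  antisymm : ∀ x y : A, br x y = - br y x
  jacobi : ∀ x y z : A, br x (br y z) + br y (br z x) + br z (br x y) = 0
  leibniz : ∀ x y z : A, br x (y * z) = br x y * z + y * br x z
  scalar : ∀ (c : ℂ) (x : A), br (algebraMap ℂ A c) x = 0

variable {A : Type*} [CommRing A] [Algebra ℂ A]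

/-- The two-variable bracket `{p(λ), q(μ)} = Σ_{i,j} {p_i, q_j} λ^i μ^j` as an element of
`A[λ,μ] = (A[μ])[λ]` (outer variable `λ`, inner variable `μ`). -/
noncomputable def br2 (P : PoissonC A) (p q : Polynomial A) :
    Polynomial (Polynomial A) :=
  ∑ i ∈ p.support, ∑ j ∈ q.support,
    Polynomial.C (Polynomial.C (P.br (p.coeff i) (q.coeff j)) * Polynomial.X ^ j)
      * Polynomial.X ^ i

/-- `p(λ)`: the image of `p ∈ A[X]` in `A[λ,μ]` under `X ↦ λ`. -/
noncomputable def pl (p : Polynomial A) : Polynomial (Polynomial A) :=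
  p.map Polynomial.C

/-- `p(μ)`: the image of `p ∈ A[X]` in `A[λ,μ]` under `X ↦ μ`. -/
noncomputable def pm (p : Polynomial A) : Polynomial (Polynomial A) :=
  Polynomial.C p

/-- Tensor Poisson bracket `{L₁(λ) ⊗, L₂(μ)}` of a 2×2 polynomial matrix with itself,
as a 4×4 matrix over `A[λ,μ]`. -/
noncomputable def tbr2 (P : PoissonC A) (L L' : Matrix (Fin 2) (Fin 2) (Polynomial A)) :
    Matrix (Fin 2 × Fin 2) (Fin 2 × Fin 2) (Polynomial (Polynomial A)) :=
  Matrix.of fun p q => br2 P (L p.1 q.1) (L' p.2 q.2)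

/-- The 4×4 swap matrix over a commutative ring `R`. -/
def swapM (R : Type*) [CommRing R] : Matrix (Fin 2 × Fin 2) (Fin 2 × Fin 2) R :=
  Matrix.of fun p q => if p.1 = q.2 ∧ p.2 = q.1 then 1 else 0

/-- σ₋ = [[0,0],[1,0]] over a commutative ring `R`. -/
def σm (R : Type*) [CommRing R] : Matrix (Fin 2) (Fin 2) R := !![0, 0; 1, 0]

/-- Matrix commutator. -/
def mcomm {R ι : Type*} [CommRing R] [Fintype ι] [DecidableEq ι]
    (X Y : Matrix ι ι R) : Matrix ι ι R :=
  X * Y - Y * X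

namespace PoissonC

/-- The bracket as a biadditive map. -/
def brHom (P : PoissonC A) : A →+ A →+ A :=
  AddMonoidHom.mk' (fun x => AddMonoidHom.mk' (P.br x) (P.add_right x)) fun x y =>
    AddMonoidHom.ext fun z => P.add_left x y z

theorem brHom_apply (P : PoissonC A) (x y : A) : P.brHom x y = P.br x y := rfl

theorem zero_br (P : PoissonC A) (x : A) : P.br 0 x = 0 := by
  simp [← brHom_apply]

theorem br_zero (P : PoissonC A) (x : A) : P.br x 0 = 0 := by
  simp [← brHom_apply]

theorem br_neg (P : PoissonC A) (x y : A) : P.br x (-y) = -P.br x y := by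
  simp [← brHom_apply]

theorem neg_br (P : PoissonC A) (x y : A) : P.br (-x) y = -P.br x y := by
  simp [← brHom_apply]

theorem mul_br (P : PoissonC A) (x y z : A) :
    P.br (x * y) z = x * P.br y z + P.br x z * y := by
  rw [P.antisymm, P.leibniz, P.antisymm x z, P.antisymm y z]
  ring

theorem sum_br (P : PoissonC A) {ι : Type*} (s : Finset ι) (g : ι → A) (x : A) :
    P.br (∑ i ∈ s, g i) x = ∑ i ∈ s, P.br (g i) x := by
  simp [← brHom_apply]

end PoissonC

theorem coeff_coeff_br2 (P : PoissonC A) (p q : Polynomial A) (i j : ℕ) :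
    ((br2 P p q).coeff i).coeff j = P.br (p.coeff i) (q.coeff j) := by
  have hinner : ∀ k, (∑ l ∈ q.support,
      Polynomial.C (P.br (p.coeff k) (q.coeff l)) * Polynomial.X ^ l).coeff j
        = P.br (p.coeff k) (q.coeff j) := by
    intro k
    simp only [Polynomial.finsetSum_coeff, Polynomial.coeff_C_mul_X_pow]
    by_cases hj : j ∈ q.support
    · simp [Finset.sum_ite_eq, hj]
    · simp [Finset.sum_ite_eq, hj, Polynomial.notMem_support_iff.mp hj, P.br_zero]
  simp only [br2, ← Finset.sum_mul, ← map_sum]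
  rw [Polynomial.finsetSum_coeff]
  simp only [Polynomial.coeff_C_mul_X_pow]
  rw [Finset.sum_ite_eq]
  split_ifs with hi
  · exact hinner i
  · rw [Polynomial.notMem_support_iff.mp hi, P.zero_br, Polynomial.coeff_zero]

theorem br2_ext {R : Type*} [CommRing R] {p q : Polynomial (Polynomial R)}
    (h : ∀ i j, (p.coeff i).coeff j = (q.coeff i).coeff j) : p = q :=
  Polynomial.ext fun i => Polynomial.ext fun j => h i j

theorem br2_add_left (P : PoissonC A) (p p' q : Polynomial A) :
    br2 P (p + p') q = br2 P p q + br2 P p' q :=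
  br2_ext fun i j => by simp [coeff_coeff_br2, P.add_left]

theorem br2_add_right (P : PoissonC A) (p q q' : Polynomial A) :
    br2 P p (q + q') = br2 P p q + br2 P p q' :=
  br2_ext fun i j => by simp [coeff_coeff_br2, P.add_right]

theorem br2_neg_left (P : PoissonC A) (p q : Polynomial A) :
    br2 P (-p) q = -br2 P p q :=
  br2_ext fun i j => by simp [coeff_coeff_br2, P.neg_br]

theorem br2_neg_right (P : PoissonC A) (p q : Polynomial A) :
    br2 P p (-q) = -br2 P p q :=
  br2_ext fun i j => by simp [coeff_coeff_br2, P.br_neg]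

theorem br2_map_algebraMap_left (P : PoissonC A) (f : Polynomial ℂ) (q : Polynomial A) :
    br2 P (f.map (algebraMap ℂ A)) q = 0 :=
  br2_ext fun i j => by simp [coeff_coeff_br2, P.scalar]

theorem br2_mul_left (P : PoissonC A) (p g q : Polynomial A) :
    br2 P (p * g) q = pl p * br2 P g q + br2 P p q * pl g :=
  br2_ext fun i j => by
    rw [coeff_coeff_br2, Polynomial.coeff_mul, Polynomial.coeff_add, Polynomial.coeff_add,
      Polynomial.coeff_mul, Polynomial.coeff_mul]
    simp only [pl, coeff_coeff_br2, Polynomial.finsetSum_coeff, Polynomial.coeff_map, P.sum_br,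
      P.mul_br, Polynomial.coeff_C_mul, Polynomial.coeff_mul_C, Finset.sum_add_distrib]

theorem coeff_coeff_swap {R : Type*} [CommRing R] (p : Polynomial (Polynomial R)) (i j : ℕ) :
    ((Polynomial.Bivariate.swap p).coeff i).coeff j = (p.coeff j).coeff i := by
  induction p using Polynomial.induction_on' with
  | add p q hp hq => simp only [map_add, Polynomial.coeff_add, hp, hq]
  | monomial n f =>
    induction f using Polynomial.induction_on' with
    | add f g hf hg => simp only [map_add, Polynomial.coeff_add, hf, hg]
    | monomial m r =>
      rw [Polynomial.Bivariate.swap_monomial_monomial]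
      simp only [Polynomial.coeff_monomial]
      split_ifs <;> simp_all [Polynomial.coeff_monomial]

theorem br2_antisymm (P : PoissonC A) (p q : Polynomial A) :
    br2 P q p = -Polynomial.Bivariate.swap (br2 P p q) :=
  br2_ext fun i j => by
    simp only [Polynomial.coeff_neg, coeff_coeff_swap, coeff_coeff_br2]
    exact P.antisymm _ _

theorem sub_mul_br2_antisymm (P : PoissonC A) (p q : Polynomial A) :
    (Polynomial.X - Polynomial.C Polynomial.X) * br2 P q p
      = Polynomial.Bivariate.swap
          ((Polynomial.X - Polynomial.C Polynomial.X) * br2 P p q) := by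
  rw [br2_antisymm, map_mul, map_sub, Polynomial.Bivariate.swap_X, Polynomial.Bivariate.swap_Y]
  ring

theorem swap_pl {R : Type*} [CommRing R] (p : Polynomial R) : Polynomial.Bivariate.swap (pl p) = pm p :=
  Polynomial.Bivariate.swap_map_C p

theorem swap_pm {R : Type*} [CommRing R] (p : Polynomial R) : Polynomial.Bivariate.swap (pm p) = pl p :=
  Polynomial.Bivariate.swap_C p

theorem algebraMap_eq_C_C (η : ℂ) :
    algebraMap ℂ (Polynomial (Polynomial A)) η
      = Polynomial.C (Polynomial.C (algebraMap ℂ A η)) := rfl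

theorem swap_algebraMap (η : ℂ) :
    Polynomial.Bivariate.swap (algebraMap ℂ (Polynomial (Polynomial A)) η)
      = algebraMap ℂ (Polynomial (Polynomial A)) η := by
  rw [algebraMap_eq_C_C, Polynomial.Bivariate.swap_C_C]

theorem eval_X_pl {R : Type*} [CommRing R] (p : Polynomial R) : (pl p).eval Polynomial.X = p := by
  rw [pl, Polynomial.eval_map, Polynomial.eval₂_C_X]

theorem eval_X_pm {R : Type*} [CommRing R] (p : Polynomial R) : (pm p).eval Polynomial.X = p :=
  Polynomial.eval_C

theorem pl_add {R : Type*} [CommRing R] (p q : Polynomial R) : pl (p + q) = pl p + pl q := Polynomial.map_add _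

theorem pl_mul {R : Type*} [CommRing R] (p q : Polynomial R) : pl (p * q) = pl p * pl q := Polynomial.map_mul _

theorem pl_neg {R : Type*} [CommRing R] (p : Polynomial R) : pl (-p) = -pl p := Polynomial.map_neg _

theorem pm_add {R : Type*} [CommRing R] (p q : Polynomial R) : pm (p + q) = pm p + pm q := Polynomial.C_add

theorem pm_mul {R : Type*} [CommRing R] (p q : Polynomial R) : pm (p * q) = pm p * pm q := Polynomial.C_mul

theorem pm_neg {R : Type*} [CommRing R] (p : Polynomial R) : pm (-p) = -pm p := Polynomial.C_neg

theorem natDegree_pl_le {R : Type*} [CommRing R] (p : Polynomial R) : (pl p).natDegree ≤ p.natDegree :=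
  Polynomial.natDegree_map_le

theorem natDegree_pl_mul_pm_le {R : Type*} [CommRing R] (p q : Polynomial R) :
    (pl p * pm q).natDegree ≤ p.natDegree :=
  (Polynomial.natDegree_mul_C_le _ _).trans (natDegree_pl_le p)

theorem natDegree_algebraMap_mul_le (η : ℂ) (p : Polynomial (Polynomial A)) :
    (algebraMap ℂ (Polynomial (Polynomial A)) η * p).natDegree ≤ p.natDegree := by
  rw [algebraMap_eq_C_C]
  exact Polynomial.natDegree_C_mul_le _ _

theorem natDegree_sub_mul_br2_le (P : PoissonC A) {p q : Polynomial A} {n : ℕ}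
    (hp : p.degree < n) :
    ((Polynomial.X - Polynomial.C Polynomial.X) * br2 P p q).natDegree ≤ n := by
  have hB : ∀ m, n ≤ m → (br2 P p q).coeff m = 0 := fun m hm =>
    Polynomial.ext fun j => by
      rw [coeff_coeff_br2, Polynomial.coeff_eq_zero_of_degree_lt
        (hp.trans_le (by exact_mod_cast hm)), P.zero_br, Polynomial.coeff_zero]
  rw [Polynomial.natDegree_le_iff_coeff_eq_zero]
  rintro (_ | m) hm
  · omega
  · rw [sub_mul, Polynomial.coeff_sub, Polynomial.coeff_X_mul, Polynomial.coeff_C_mul,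
      hB m (by omega), hB (m + 1) (by omega), mul_zero, sub_zero]

/-- A polynomial of two variables vanishing on the diagonal is zero as soon as its product with a
monic `b(λ)` has degree at most that of `b` in `λ`. -/
theorem eq_zero_of_natDegree_pl_mul_le {R : Type*} [CommRing R] {b : Polynomial R} (hb : b.Monic)
    {U : Polynomial (Polynomial R)} (hU : U.eval Polynomial.X = 0)
    (hdeg : (pl b * U).natDegree ≤ b.natDegree) : U = 0 := by
  nontriviality R
  by_contra hne
  have hpl : (pl b).Monic := hb.map _
  have hn : (pl b).natDegree = b.natDegree := hb.natDegree_map _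
  rw [hpl.natDegree_mul' hne, hn] at hdeg
  have hC := Polynomial.eq_C_of_natDegree_le_zero (p := U) (by omega)
  rw [hC, Polynomial.eval_C] at hU
  exact hne (by rw [hC, hU, Polynomial.C_0])

/-- The bracket of a quotient `f / b` is determined by the bracket of `b`: it is the only
candidate vanishing on the diagonal and having the right polynomial part. -/
theorem sub_mul_br2_divByMonic (P : PoissonC A) {b : Polynomial A} (hb : b.Monic)
    (f : Polynomial ℂ) {q : Polynomial A} {E U : Polynomial (Polynomial A)}
    (hE : (Polynomial.X - Polynomial.C Polynomial.X) * br2 P b q = E)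
    (hU : U.eval Polynomial.X = 0)
    (hdeg : (pl b * U + E * pl (f.map (algebraMap ℂ A) /ₘ b)).natDegree ≤ b.natDegree) :
    (Polynomial.X - Polynomial.C Polynomial.X) * br2 P (f.map (algebraMap ℂ A) /ₘ b) q = U := by
  nontriviality A
  set F := f.map (algebraMap ℂ A) with hF
  have hbr : br2 P (F %ₘ b) q + (pl b * br2 P (F /ₘ b) q + br2 P b q * pl (F /ₘ b)) = 0 := by
    rw [← br2_mul_left, ← br2_add_left, Polynomial.modByMonic_add_div, hF,
      br2_map_algebraMap_left]
  have hr := natDegree_sub_mul_br2_le P (q := q)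
    ((Polynomial.degree_modByMonic_lt F hb).trans_le Polynomial.degree_le_natDegree)
  rw [← sub_eq_zero]
  apply eq_zero_of_natDegree_pl_mul_le hb
  · simp [hU]
  · have : pl b * ((Polynomial.X - Polynomial.C Polynomial.X) * br2 P (F /ₘ b) q - U)
        = -((Polynomial.X - Polynomial.C Polynomial.X) * br2 P (F %ₘ b) q)
          - (pl b * U + E * pl (F /ₘ b)) := by
      rw [← hE]
      linear_combination (Polynomial.X - Polynomial.C Polynomial.X) * hbr
    rw [this]
    exact (Polynomial.natDegree_sub_le _ _).trans
      (max_le ((Polynomial.natDegree_neg _).trans_le hr) hdeg)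

theorem Polynomial.divByMonic_divByMonic_self {R : Type*} [CommRing R] {b : Polynomial R} (hb : b.Monic)
    (F : Polynomial R) : F /ₘ b /ₘ b = F /ₘ b ^ 2 := by
  nontriviality R
  refine (Polynomial.div_modByMonic_unique _ (F %ₘ b + b * (F /ₘ b %ₘ b)) (hb.pow 2)
    ⟨?_, ?_⟩).1.symm
  · linear_combination Polynomial.modByMonic_add_div F b
      + b * Polynomial.modByMonic_add_div (F /ₘ b) b
  · have h1 : (b * (F /ₘ b %ₘ b)).degree < (b ^ 2).degree := by
      rw [pow_two, hb.degree_mul, mul_comm, hb.degree_mul]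
      exact WithBot.add_lt_add_right (Polynomial.degree_ne_bot.mpr hb.ne_zero)
        (Polynomial.degree_modByMonic_lt _ hb)
    have h2 : b.degree ≤ (b ^ 2).degree := by
      rw [pow_two, hb.degree_mul]
      exact le_add_of_nonneg_right (Polynomial.zero_le_degree_iff.mpr hb.ne_zero)
    exact (Polynomial.degree_add_le _ _).trans_lt
      (max_lt ((Polynomial.degree_modByMonic_lt _ hb).trans_le h2) h1)

/-- the polynomially deformed matrix `L = [[a,b],[G+c,−a]]`, with `G = [f b⁻¹]₊`
the quotient of `f` by the monic polynomial `b`, obeys the rs-matrix algebra whose dynamical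
coefficient is the divided difference of `Q = [f b⁻²]₊`, the quotient of `f` by `b²`. -/
theorem statement4 (P : PoissonC A) (η : ℂ)
    (a b c : Polynomial A) (hb : b.Monic)
    -- the rational (XXX) loop-sl₂ relations for (a, b, c), as identities in A[λ,μ]
    (haa : br2 P a a = 0) (hbb : br2 P b b = 0) (hcc : br2 P c c = 0)
    (hab : (Polynomial.X - Polynomial.C Polynomial.X) * br2 P a b
      = algebraMap ℂ (Polynomial (Polynomial A)) η * (pm b - pl b))
    (hac : (Polynomial.X - Polynomial.C Polynomial.X) * br2 P a c
      = algebraMap ℂ (Polynomial (Polynomial A)) η * (pl c - pm c))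
    (hbc : (Polynomial.X - Polynomial.C Polynomial.X) * br2 P b c
      = algebraMap ℂ (Polynomial (Polynomial A)) (2 * η) * (pm a - pl a))
    (f : Polynomial ℂ)
    (G Q : Polynomial A)
    (hG : G = f.map (algebraMap ℂ A) /ₘ b)
    (hQ : Q = f.map (algebraMap ℂ A) /ₘ (b ^ 2))
    (L : Matrix (Fin 2) (Fin 2) (Polynomial A))
    (hL : L = !![a, b; G + c, -a]) :
    ((Polynomial.X - Polynomial.C Polynomial.X : Polynomial (Polynomial A))) • tbr2 P L L
      = algebraMap ℂ (Polynomial (Polynomial A)) η •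
          mcomm (swapM (Polynomial (Polynomial A)))
            ((L.map pl) ⊗ₖ (1 : Matrix (Fin 2) (Fin 2) (Polynomial (Polynomial A)))
              + (1 : Matrix (Fin 2) (Fin 2) (Polynomial (Polynomial A))) ⊗ₖ (L.map pm))
        + (algebraMap ℂ (Polynomial (Polynomial A)) η * (pl Q - pm Q)) •
          mcomm (σm (Polynomial (Polynomial A)) ⊗ₖ σm (Polynomial (Polynomial A)))
            ((L.map pl) ⊗ₖ (1 : Matrix (Fin 2) (Fin 2) (Polynomial (Polynomial A)))
              - (1 : Matrix (Fin 2) (Fin 2) (Polynomial (Polynomial A))) ⊗ₖ (L.map pm)) := by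
  have hQ' : G /ₘ b = Q := by rw [hG, hQ, Polynomial.divByMonic_divByMonic_self hb]
  clear hQ
  set s := G %ₘ b
  set H := (a * s) /ₘ b
  set t := (a * s) %ₘ b
  have hs : G = s + b * Q := by rw [← hQ', Polynomial.modByMonic_add_div]
  have ht : a * s = t + b * H := (Polynomial.modByMonic_add_div _ _).symm
  have hsdeg : s.natDegree ≤ b.natDegree := Polynomial.natDegree_modByMonic_le _ hb
  have htdeg : t.natDegree ≤ b.natDegree := Polynomial.natDegree_modByMonic_le _ hb
  have hsl : pl G = pl s + pl b * pl Q := by rw [← pl_mul, ← pl_add, ← hs]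
  have hsm : pm G = pm s + pm b * pm Q := by rw [← pm_mul, ← pm_add, ← hs]
  have htl : pl a * pl s = pl t + pl b * pl H := by rw [← pl_mul, ht, pl_add, pl_mul]
  have hη : algebraMap ℂ (Polynomial (Polynomial A)) (2 * η)
      = 2 * algebraMap ℂ (Polynomial (Polynomial A)) η := by rw [map_mul, map_ofNat]
  set h := algebraMap ℂ (Polynomial (Polynomial A)) η with hh
  have hba : (Polynomial.X - Polynomial.C Polynomial.X) * br2 P b a = h * (pl b - pm b) := by
    rw [sub_mul_br2_antisymm, hab, hh]
    simp only [map_mul, map_sub, swap_algebraMap, swap_pl, swap_pm]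
  have hca : (Polynomial.X - Polynomial.C Polynomial.X) * br2 P c a = h * (pm c - pl c) := by
    rw [sub_mul_br2_antisymm, hac, hh]
    simp only [map_mul, map_sub, swap_algebraMap, swap_pl, swap_pm]
  have hcb : (Polynomial.X - Polynomial.C Polynomial.X) * br2 P c b = 2 * h * (pl a - pm a) := by
    rw [sub_mul_br2_antisymm, hbc, hη, hh]
    simp only [map_mul, map_sub, swap_algebraMap, swap_pl, swap_pm, map_ofNat]
  have hGq : ∀ q E U, (Polynomial.X - Polynomial.C Polynomial.X) * br2 P b q = E →
      U.eval Polynomial.X = 0 → (pl b * U + E * pl G).natDegree ≤ b.natDegree →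
      (Polynomial.X - Polynomial.C Polynomial.X) * br2 P G q = U := by
    intro q E U hE hU hdeg
    rw [hG] at hdeg ⊢
    exact sub_mul_br2_divByMonic P hb f hE hU hdeg
  have hGb : (Polynomial.X - Polynomial.C Polynomial.X) * br2 P G b = 0 :=
    hGq b 0 0 (by simp [hbb]) (by simp) (by simp)
  have hbG : (Polynomial.X - Polynomial.C Polynomial.X) * br2 P b G = 0 := by
    rw [sub_mul_br2_antisymm, hGb, map_zero]
  have hGG : (Polynomial.X - Polynomial.C Polynomial.X) * br2 P G G = 0 :=
    hGq G 0 0 hbG (by simp) (by simp)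
  have hGa : (Polynomial.X - Polynomial.C Polynomial.X) * br2 P G a
      = h * (pm G - pl G - (pm Q - pl Q) * pm b) := by
    refine hGq a _ _ hba (by simp [eval_X_pl, eval_X_pm]) ?_
    have : pl b * (h * (pm G - pl G - (pm Q - pl Q) * pm b)) + h * (pl b - pm b) * pl G
        = h * (pl b * pm s - pl s * pm b) := by
      rw [hsl, hsm]
      ring
    rw [this]
    exact (natDegree_algebraMap_mul_le _ _).trans <| (Polynomial.natDegree_sub_le _ _).trans <|
      max_le (natDegree_pl_mul_pm_le _ _) ((natDegree_pl_mul_pm_le _ _).trans hsdeg)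
  have haG : (Polynomial.X - Polynomial.C Polynomial.X) * br2 P a G
      = h * (pl G - pm G - (pl Q - pm Q) * pl b) := by
    rw [sub_mul_br2_antisymm, hGa, hh]
    simp only [map_mul, map_sub, swap_algebraMap, swap_pl, swap_pm]
  have hGc : (Polynomial.X - Polynomial.C Polynomial.X) * br2 P G c
      = 2 * h * (pl Q * (pl a - pm a) + (pl H - pm H)) := by
    refine hGq c _ _ hbc (by simp [eval_X_pl, eval_X_pm]) ?_
    have : pl b * (2 * h * (pl Q * (pl a - pm a) + (pl H - pm H)))
          + algebraMap ℂ (Polynomial (Polynomial A)) (2 * η) * (pm a - pl a) * pl G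
        = algebraMap ℂ (Polynomial (Polynomial A)) (2 * η)
          * (pl s * pm a - pl t - pl b * pm H) := by
      rw [hη, hsl]
      linear_combination -2 * h * htl
    rw [this]
    exact (natDegree_algebraMap_mul_le _ _).trans <| (Polynomial.natDegree_sub_le _ _).trans <|
      max_le ((Polynomial.natDegree_sub_le _ _).trans <|
        max_le ((natDegree_pl_mul_pm_le _ _).trans hsdeg) ((natDegree_pl_le _).trans htdeg))
        (natDegree_pl_mul_pm_le _ _)
  have hcG : (Polynomial.X - Polynomial.C Polynomial.X) * br2 P c G
      = 2 * h * (pm Q * (pm a - pl a) + (pm H - pl H)) := by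
    rw [sub_mul_br2_antisymm, hGc, hh]
    simp only [map_mul, map_sub, map_add, swap_algebraMap, swap_pl, swap_pm, map_ofNat]
  rw [hη] at hbc
  subst hL
  clear_value h
  ext ⟨i, k⟩ ⟨j, l⟩ : 1
  fin_cases i <;> fin_cases k <;> fin_cases j <;> fin_cases l <;>
    simp [tbr2, mcomm, swapM, σm, Matrix.mul_apply, Fintype.sum_prod_type, Fin.sum_univ_two,
      Matrix.one_apply, br2_add_left, br2_add_right, br2_neg_left, br2_neg_right, mul_add,
      haa, hbb, hcc, hab, hac, hbc, hba, hca, hcb, hGb, hbG, hGG, hGa, haG, hGc, hcG,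
      pl_add, pm_add, pl_neg, pm_neg] <;>
    first
    | ring1
    | linear_combination -hba
    | linear_combination -hab
    | linear_combination -hca - hGa
    | linear_combination -haG - hac
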